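/- arXiv:2410.01410 — 3 statements merged into one kernel-verified Lean document; each statement's English description precedes it below -/
import Mathlib

section
/- Under the stated setup, the function γM^γ satisfies the Polyak–Łojasiewicz inequality: for every x ∈ ℝ^d, ‖γ∇M^γ(x)‖² ≥ 2 · (γμ / (4(1 + γL_max))) · (γM^γ(x) − γM^γ_inf). -/
section FirstOrder

variable {E : Type*} [NormedAddCommGroup E] [InnerProductSpace ℝ E] [CompleteSpace E]

theorem HasGradientAt.hasDerivAt_add_smul {f : E → ℝ} {g x d : E} {t : ℝ}
    (h : HasGradientAt f g (x + t • d)) :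
    HasDerivAt (fun s : ℝ => f (x + s • d)) (inner ℝ g d) t := by
  have hline : HasDerivAt (fun s : ℝ => x + s • d) d t := by
    simpa using ((hasDerivAt_id t).smul_const d).const_add x
  simpa [Function.comp_def] using h.hasFDerivAt.comp_hasDerivAt t hline

theorem ConvexOn.add_inner_le_of_hasGradientAt {f : E → ℝ} (hf : ConvexOn ℝ Set.univ f)
    {g x : E} (h : HasGradientAt f g x) (y : E) : f x + inner ℝ g (y - x) ≤ f y := by
  have hline : ConvexOn ℝ Set.univ (fun s : ℝ => f (x + s • (y - x))) := by
    refine ⟨convex_univ, fun a _ b _ s t hs ht hst => ?_⟩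
    have hpt : x + (s • a + t • b) • (y - x)
        = s • (x + a • (y - x)) + t • (x + b • (y - x)) := by
      obtain rfl : s = 1 - t := by linarith
      simp only [smul_eq_mul]
      module
    simp only [hpt]
    exact hf.2 (Set.mem_univ _) (Set.mem_univ _) hs ht hst
  have hderiv : HasDerivAt (fun s : ℝ => f (x + s • (y - x))) (inner ℝ g (y - x)) 0 :=
    HasGradientAt.hasDerivAt_add_smul (by simpa using h)
  have hslope := hline.le_slope_of_hasDerivAt (Set.mem_univ 0) (Set.mem_univ 1) one_pos hderiv
  simp [slope_def_field] at hslope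
  linarith

/-- The descent lemma: a function with Lipschitz gradient lies below its quadratic upper model. -/
theorem le_add_inner_add_of_gradient_lipschitz {f : E → ℝ} {f' : E → E} {L : ℝ}
    (hf : ∀ x, HasGradientAt f (f' x) x) (hL : ∀ x y, ‖f' x - f' y‖ ≤ L * ‖x - y‖) (x y : E) :
    f y ≤ f x + inner ℝ (f' x) (y - x) + L / 2 * ‖y - x‖ ^ 2 := by
  set d := y - x with hd
  have hderiv (t : ℝ) : HasDerivAt
      (fun s : ℝ => f (x + s • d) - s * inner ℝ (f' x) d - s ^ 2 * (L / 2 * ‖d‖ ^ 2))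
      (inner ℝ (f' (x + t • d)) d - inner ℝ (f' x) d - 2 * t * (L / 2 * ‖d‖ ^ 2)) t := by
    have h1 := (hf (x + t • d)).hasDerivAt_add_smul
    have h2 := (hasDerivAt_id t).mul_const (inner ℝ (f' x) d)
    have h3 := (hasDerivAt_pow 2 t).mul_const (L / 2 * ‖d‖ ^ 2)
    simpa using (h1.fun_sub h2).fun_sub h3
  have hanti := antitoneOn_of_deriv_nonpos (convex_Icc (0 : ℝ) 1)
    (fun t _ => (hderiv t).continuousAt.continuousWithinAt)
    (fun t _ => (hderiv t).differentiableAt.differentiableWithinAt) (fun t ht => by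
      rw [interior_Icc] at ht
      rw [(hderiv t).deriv, ← inner_sub_left]
      have h1 := real_inner_le_norm (f' (x + t • d) - f' x) d
      have h2 := hL (x + t • d) x
      rw [add_sub_cancel_left, norm_smul, Real.norm_of_nonneg ht.1.le] at h2
      nlinarith [mul_le_mul_of_nonneg_right h2 (norm_nonneg d)])
  have h := hanti (Set.left_mem_Icc.2 zero_le_one) (Set.right_mem_Icc.2 zero_le_one) zero_le_one
  have hy : x + d = y := by rw [hd]; abel
  simp [hy] at h
  linarith

theorem norm_gradient_sq_le_of_forall_le {f : E → ℝ} {f' : E → E} {L : ℝ} (hLpos : 0 < L)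
    (hf : ∀ x, HasGradientAt f (f' x) x) (hL : ∀ x y, ‖f' x - f' y‖ ≤ L * ‖x - y‖)
    {m : ℝ} (hm : ∀ x, m ≤ f x) (x : E) : ‖f' x‖ ^ 2 ≤ 2 * L * (f x - m) := by
  have h := le_add_inner_add_of_gradient_lipschitz hf hL x (x - L⁻¹ • f' x)
  have hstep : x - L⁻¹ • f' x - x = -(L⁻¹ • f' x) := by abel
  rw [hstep, inner_neg_right, real_inner_smul_right, real_inner_self_eq_norm_sq, norm_neg,
    norm_smul, Real.norm_of_nonneg (inv_pos.2 hLpos).le] at h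
  have hquad : L / 2 * (L⁻¹ * ‖f' x‖) ^ 2 = L⁻¹ * ‖f' x‖ ^ 2 / 2 := by field_simp
  have hle : L⁻¹ * ‖f' x‖ ^ 2 ≤ 2 * (f x - m) := by linarith [hm (x - L⁻¹ • f' x)]
  rw [inv_mul_le_iff₀ hLpos] at hle
  linarith

/-- For a smooth function bounded below by `m`, the objective defining the Moreau envelope
dominates the function up to the factor `1 + γ * L`. -/
theorem sub_le_mul_moreau_objective {f : E → ℝ} {f' : E → E} {L γ : ℝ} (hLpos : 0 < L)
    (hγ : 0 < γ) (hf : ∀ x, HasGradientAt f (f' x) x)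
    (hL : ∀ x y, ‖f' x - f' y‖ ≤ L * ‖x - y‖) {m : ℝ} (hm : ∀ x, m ≤ f x) (x z : E) :
    f x - m ≤ (1 + γ * L) * (f z + ‖z - x‖ ^ 2 / (2 * γ) - m) := by
  have h1 := le_add_inner_add_of_gradient_lipschitz hf hL z x
  have h2 := norm_gradient_sq_le_of_forall_le hLpos hf hL hm z
  have h3 := real_inner_le_norm (f' z) (x - z)
  rw [norm_sub_rev z x]
  set a := ‖f' z‖
  set r := ‖x - z‖
  have h4 : a * r ≤ γ / 2 * a ^ 2 + r ^ 2 / (2 * γ) := by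
    have : γ / 2 * a ^ 2 + r ^ 2 / (2 * γ) - a * r = (γ * a - r) ^ 2 / (2 * γ) := by
      field_simp
      ring
    have : 0 ≤ (γ * a - r) ^ 2 / (2 * γ) := by positivity
    linarith
  have h5 : γ * L * (r ^ 2 / (2 * γ)) = L / 2 * r ^ 2 := by field_simp
  nlinarith [mul_le_mul_of_nonneg_left h2 hγ.le]

theorem gradient_eq_of_isMinOn_moreau_objective {f : E → ℝ} {g x p : E} {γ : ℝ}
    (hf : HasGradientAt f g p)
    (hp : IsMinOn (fun z => f z + ‖z - x‖ ^ 2 / (2 * γ)) Set.univ p) : g = γ⁻¹ • (x - p) := by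
  refine ext_inner_right ℝ fun d => ?_
  have h1 : HasDerivAt (fun s : ℝ => f (p + s • d)) (inner ℝ g d) 0 :=
    HasGradientAt.hasDerivAt_add_smul (by simpa using hf)
  have hline : HasDerivAt (fun s : ℝ => p + s • d - x) d 0 := by
    simpa using (((hasDerivAt_id (0 : ℝ)).smul_const d).const_add p).sub_const x
  have h2 := h1.add (hline.norm_sq.div_const (2 * γ))
  have hmin : IsLocalMin (fun s : ℝ => f (p + s • d) + ‖p + s • d - x‖ ^ 2 / (2 * γ)) 0 :=
    Filter.Eventually.of_forall fun s => by
      simpa using isMinOn_iff.1 hp (p + s • d) (Set.mem_univ _)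
  have h3 := hmin.hasDerivAt_eq_zero h2
  rw [zero_smul, add_zero, mul_div_mul_left _ _ two_ne_zero] at h3
  rw [real_inner_smul_left, ← neg_sub p x, inner_neg_left]
  rw [div_eq_inv_mul] at h3
  linarith

theorem ConvexOn.moreau_sub_le_inner {f : E → ℝ} (hf : ConvexOn ℝ Set.univ f) {g x p : E} {γ : ℝ}
    (hγ : 0 < γ) (hg : HasGradientAt f g p)
    (hp : IsMinOn (fun z => f z + ‖z - x‖ ^ 2 / (2 * γ)) Set.univ p) (y : E) :
    f p + ‖p - x‖ ^ 2 / (2 * γ) - f y ≤ γ⁻¹ * inner ℝ (x - p) (x - y) := by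
  have h := hf.add_inner_le_of_hasGradientAt hg y
  rw [gradient_eq_of_isMinOn_moreau_objective hg hp, real_inner_smul_left] at h
  have hsplit : inner ℝ (x - p) (y - p) = ‖p - x‖ ^ 2 - inner ℝ (x - p) (x - y) := by
    rw [norm_sub_rev p x, ← real_inner_self_eq_norm_sq, ← inner_sub_right]
    congr 1
    abel
  have hhalf : ‖p - x‖ ^ 2 / (2 * γ) = γ⁻¹ * ‖p - x‖ ^ 2 / 2 := by field_simp
  have : 0 ≤ γ⁻¹ * ‖p - x‖ ^ 2 := by positivity
  rw [hsplit, mul_sub] at h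
  linarith

end FirstOrder

theorem StrongConvexOn.quadratic_growth {E : Type*} [NormedAddCommGroup E] [NormedSpace ℝ E]
    {f : E → ℝ} {m : ℝ} (hf : StrongConvexOn Set.univ m f) {y : E} (hy : ∀ x, f y ≤ f x) (x : E) :
    m / 2 * ‖x - y‖ ^ 2 ≤ f x - f y := by
  have hle : ∀ t ∈ Set.Ioo (0 : ℝ) 1, (1 - t) * (m / 2 * ‖x - y‖ ^ 2) ≤ f x - f y := by
    intro t ht
    have h := hf.2 (Set.mem_univ x) (Set.mem_univ y) ht.1.le (sub_nonneg.2 ht.2.le)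
      (add_sub_cancel t 1)
    have hmin := hy (t • x + (1 - t) • y)
    simp only [smul_eq_mul] at h
    refine le_of_mul_le_mul_left ?_ ht.1
    linarith
  have hlim : Filter.Tendsto (fun t : ℝ => (1 - t) * (m / 2 * ‖x - y‖ ^ 2))
      (nhdsWithin 0 (Set.Ioi 0)) (nhds (m / 2 * ‖x - y‖ ^ 2)) := by
    have hcont : Continuous fun t : ℝ => (1 - t) * (m / 2 * ‖x - y‖ ^ 2) := by fun_prop
    simpa using (hcont.tendsto 0).mono_left nhdsWithin_le_nhds
  exact le_of_tendsto hlim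
    (Filter.mem_of_superset (Ioo_mem_nhdsGT one_pos) hle)


theorem pl_inequality
    {d n : ℕ} (hn : 1 ≤ n)
    (f : Fin n → EuclideanSpace ℝ (Fin d) → ℝ)
    (f' : Fin n → EuclideanSpace ℝ (Fin d) → EuclideanSpace ℝ (Fin d))
    (L : Fin n → ℝ) (hLpos : ∀ i, 0 < L i)
    (hdiff : ∀ i x, HasGradientAt (f i) (f' i x) x)
    (hconv : ∀ i, ConvexOn ℝ Set.univ (f i))
    (hsmooth : ∀ i x y, ‖f' i x - f' i y‖ ≤ L i * ‖x - y‖)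
    (Lmax : ℝ) (hLmax : IsGreatest (Set.range L) Lmax)
    (xstar : EuclideanSpace ℝ (Fin d)) (hinterp : ∀ i, f' i xstar = 0)
    (μ : ℝ) (hμ : 0 < μ)
    (hsc : StrongConvexOn Set.univ μ (fun x => (1 / (n : ℝ)) * ∑ i, f i x))
    (γ : ℝ) (hγ : 0 < γ)
    (prox : Fin n → EuclideanSpace ℝ (Fin d) → EuclideanSpace ℝ (Fin d))
    (hprox : ∀ i x, IsMinOn (fun z => f i z + ‖z - x‖ ^ 2 / (2 * γ)) Set.univ (prox i x))
    (hproxu : ∀ i x q, IsMinOn (fun z => f i z + ‖z - x‖ ^ 2 / (2 * γ)) Set.univ q → q = prox i x)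
    (M : EuclideanSpace ℝ (Fin d) → ℝ)
    (hM : ∀ x, M x = (1 / (n : ℝ)) * ∑ i, (f i (prox i x) + ‖prox i x - x‖ ^ 2 / (2 * γ)))
    (M' : EuclideanSpace ℝ (Fin d) → EuclideanSpace ℝ (Fin d))
    (hM' : ∀ x, M' x = (1 / ((n : ℝ) * γ)) • ∑ i, (x - prox i x))
    (hMdiff : ∀ x, HasGradientAt M (M' x) x)
    (Minf : ℝ) (hMinf : Minf = M xstar) (hMinfLB : ∀ x, Minf ≤ M x)
    : ∀ x : EuclideanSpace ℝ (Fin d),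
      ‖γ • M' x‖ ^ 2 ≥ 2 * (γ * μ / (4 * (1 + γ * Lmax))) * (γ * M x - γ * Minf) := by
  intro x
  have hnpos : (0 : ℝ) < n := by exact_mod_cast hn
  have hLle (i : Fin n) : L i ≤ Lmax := hLmax.2 ⟨i, rfl⟩
  have hLmaxpos : 0 < Lmax := (hLpos ⟨0, hn⟩).trans_le (hLle _)
  have hmin (i : Fin n) (z) : f i xstar ≤ f i z := by
    simpa [hinterp i] using (hconv i).add_inner_le_of_hasGradientAt (hdiff i xstar) z
  have hMstar : M xstar = (1 / (n : ℝ)) * ∑ i, f i xstar := by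
    rw [hM]
    congr 1
    refine Finset.sum_congr rfl fun i _ => le_antisymm ?_ ?_
    · simpa using isMinOn_iff.1 (hprox i xstar) xstar (Set.mem_univ _)
    · have : 0 ≤ ‖prox i xstar - xstar‖ ^ 2 / (2 * γ) := by positivity
      linarith [hmin i (prox i xstar)]
  have hgrowth : μ / 2 * ‖x - xstar‖ ^ 2 ≤ (1 + γ * Lmax) * (M x - Minf) := by
    have h := hsc.quadratic_growth (y := xstar) (fun z => by
      gcongr with i
      exact hmin i z) x
    refine h.trans ?_
    rw [hMinf, hMstar, hM, ← mul_sub, ← mul_sub, ← Finset.sum_sub_distrib,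
      ← Finset.sum_sub_distrib, mul_left_comm, Finset.mul_sum (a := 1 + γ * Lmax)]
    gcongr with i
    refine (sub_le_mul_moreau_objective (hLpos i) hγ (hdiff i) (hsmooth i) (hmin i) x
      (prox i x)).trans ?_
    have : 0 ≤ ‖prox i x - x‖ ^ 2 / (2 * γ) := by positivity
    gcongr
    · linarith [hmin i (prox i x)]
    · exact hLle i
  have hupper : M x - Minf ≤ ‖M' x‖ * ‖x - xstar‖ := by
    refine le_trans ?_ (real_inner_le_norm (M' x) (x - xstar))
    rw [hMinf, hMstar, hM, hM', ← mul_sub, ← Finset.sum_sub_distrib, real_inner_smul_left,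
      sum_inner, show 1 / ((n : ℝ) * γ) = 1 / n * γ⁻¹ by field_simp, mul_assoc,
      Finset.mul_sum (a := γ⁻¹)]
    gcongr with i
    exact (hconv i).moreau_sub_le_inner hγ (hdiff i _) (hprox i x) xstar
  have hgap : 0 ≤ M x - Minf := sub_nonneg.2 (hMinfLB x)
  have hc : 0 < 1 + γ * Lmax := by positivity
  have hmain : μ * (M x - Minf) ≤ 2 * (1 + γ * Lmax) * ‖M' x‖ ^ 2 := by
    rcases hgap.eq_or_lt with h0 | hpos
    · rw [← h0, mul_zero]
      positivity
    · refine le_of_mul_le_mul_right ?_ hpos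
      have hsq : (M x - Minf) ^ 2 ≤ ‖M' x‖ ^ 2 * ‖x - xstar‖ ^ 2 := by
        rw [← mul_pow]
        gcongr
      nlinarith [mul_le_mul_of_nonneg_left hsq hμ.le,
        mul_le_mul_of_nonneg_left hgrowth (sq_nonneg ‖M' x‖)]
  rw [norm_smul, Real.norm_of_nonneg hγ.le, mul_pow, ge_iff_le]
  have hrw : 2 * (γ * μ / (4 * (1 + γ * Lmax))) * (γ * M x - γ * Minf)
      = γ ^ 2 * (μ * (M x - Minf) / (2 * (1 + γ * Lmax))) := by
    field_simp
    ring
  rw [hrw]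
  gcongr
  rw [div_le_iff₀ (by positivity)]
  linarith
end

section
/- Suppose every approximate proximal point used by inexact FedExProx is an ε₁-absolute approximation, i.e., ‖x̃_{i,k+1} − prox_{γf_i}(x_k)‖² ≤ ε₁ for all i and k, where ε₁ ≥ 0, and take the extrapolation parameter α = 1/(4γL_γ). Then for every K ≥ 0, Δ_K ≤ (1 − μ / (32 L_γ (1 + γL_max)))^K · (L_γ(1 + γL_max)/μ) · Δ_0 + 12 ε₁ · ((1/γ + L_max)/μ)². -/
open scoped RealInnerProductSpace

section SmoothConvex

variable {E : Type*} [NormedAddCommGroup E] [InnerProductSpace ℝ E]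

lemma StrongConvexOn.quadratic_growth_s3 {g : E → ℝ} {μ : ℝ} (hg : StrongConvexOn Set.univ μ g)
    {z : E} (hz : ∀ x, g z ≤ g x) (x : E) : μ / 2 * ‖x - z‖ ^ 2 ≤ g x - g z := by
  by_contra! hlt
  set c := μ / 2 * ‖x - z‖ ^ 2 with hc
  have hF : 0 ≤ g x - g z := sub_nonneg.2 (hz x)
  have hcpos : 0 < c := hF.trans_lt hlt
  obtain ⟨t, ht, htF⟩ : ∃ t : ℝ, 0 < t ∧ g x - g z = (1 - 2 * t) * c :=
    ⟨(c - (g x - g z)) / (2 * c), div_pos (by linarith) (by linarith), by field_simp; ring⟩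
  have ht1 : t ≤ 1 := by nlinarith
  have h := hg.2 (Set.mem_univ x) (Set.mem_univ z) ht.le (sub_nonneg.2 ht1) (by ring)
  have hmin := hz (t • x + (1 - t) • z)
  have hsum : 0 ≤ t * (g x - g z) - t * (1 - t) * c := by
    simp only [smul_eq_mul, ← hc] at h
    linarith
  rw [htF] at hsum
  nlinarith [mul_pos (mul_pos ht ht) hcpos]

variable [CompleteSpace E]

lemma HasGradientAt.hasDerivAt_line {g : E → ℝ} {g' : E → E}
    (hg : ∀ x, HasGradientAt g (g' x) x) (x v : E) (t : ℝ) :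
    HasDerivAt (fun s : ℝ => g (x + s • v)) ⟪g' (x + t • v), v⟫ t := by
  have hline : HasDerivAt (fun s : ℝ => x + s • v) v t := by
    simpa using ((hasDerivAt_id t).smul_const v).const_add x
  exact ((hg (x + t • v)).hasFDerivAt.comp_hasDerivAt t hline).congr_deriv (by simp)

lemma le_quadratic_of_lipschitz_gradient {g : E → ℝ} {g' : E → E} {L : ℝ}
    (hg : ∀ x, HasGradientAt g (g' x) x) (hL : ∀ x y, ‖g' x - g' y‖ ≤ L * ‖x - y‖) (x v : E) :
    g (x + v) ≤ g x + ⟪g' x, v⟫ + L / 2 * ‖v‖ ^ 2 := by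
  have hder (t : ℝ) : HasDerivAt
      (fun s : ℝ => g (x + s • v) - s * ⟪g' x, v⟫ - s ^ 2 * (L / 2 * ‖v‖ ^ 2))
      (⟪g' (x + t • v), v⟫ - ⟪g' x, v⟫ - t * (L * ‖v‖ ^ 2)) t := by
    have h1 := HasGradientAt.hasDerivAt_line hg x v t
    have h2 := (hasDerivAt_id t).mul_const ⟪g' x, v⟫
    have h3 := (hasDerivAt_pow 2 t).mul_const (L / 2 * ‖v‖ ^ 2)
    refine ((h1.sub h2).sub h3).congr_deriv ?_
    norm_num
    ring
  have hanti := antitoneOn_of_deriv_nonpos (convex_Icc (0 : ℝ) 1)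
    (fun t _ => (hder t).continuousAt.continuousWithinAt)
    (fun t _ => (hder t).differentiableAt.differentiableWithinAt)
    (fun t ht => by
      rw [interior_Icc] at ht
      rw [(hder t).deriv, ← inner_sub_left]
      have h1 := real_inner_le_norm (g' (x + t • v) - g' x) v
      have h2 := hL (x + t • v) x
      rw [add_sub_cancel_left, norm_smul, Real.norm_of_nonneg ht.1.le] at h2
      nlinarith [mul_le_mul_of_nonneg_right h2 (norm_nonneg v)])
  have h := hanti (Set.left_mem_Icc.2 zero_le_one) (Set.right_mem_Icc.2 zero_le_one) zero_le_one
  simp only [one_smul, one_mul, one_pow, zero_smul, add_zero, zero_mul, ne_eq, OfNat.ofNat_ne_zero,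
    not_false_eq_true, zero_pow, sub_zero] at h
  linarith

lemma ConvexOn.add_inner_gradient_le {g : E → ℝ} {g' : E → E} (hc : ConvexOn ℝ Set.univ g)
    (hg : ∀ x, HasGradientAt g (g' x) x) (x y : E) : g x + ⟪g' x, y - x⟫ ≤ g y := by
  have hline : ConvexOn ℝ Set.univ (fun s : ℝ => g (x + s • (y - x))) := by
    have h := hc.comp_affineMap (AffineMap.lineMap (k := ℝ) x y)
    refine h.congr fun s _ => ?_
    simp [AffineMap.lineMap_apply, add_comm]
  have h := hline.le_slope_of_hasDerivAt (Set.mem_univ 0) (Set.mem_univ 1) zero_lt_one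
    (HasGradientAt.hasDerivAt_line hg x (y - x) 0)
  simp [slope_def_field] at h
  linarith

lemma sub_prox_eq_smul_gradient {g : E → ℝ} {g' : E → E} (hg : ∀ x, HasGradientAt g (g' x) x)
    {γ : ℝ} (hγ : 0 < γ) {x p : E}
    (hp : IsMinOn (fun z => g z + ‖z - x‖ ^ 2 / (2 * γ)) Set.univ p) : x - p = γ • g' p := by
  have hsq : HasFDerivAt (fun z : E => ‖z - x‖ ^ 2 / (2 * γ))
      ((2 * γ)⁻¹ • (2 • innerSL ℝ (p - x))) p := by
    have h := ((hasFDerivAt_id p).sub_const x).norm_sq.const_mul (2 * γ)⁻¹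
    refine (h.congr_fderiv ?_).congr_of_eventuallyEq (.of_forall fun z => ?_)
    · ext; simp
    · simp [div_eq_inv_mul]
  have h0 := (hp.isLocalMin Filter.univ_mem).hasFDerivAt_eq_zero ((hg p).hasFDerivAt.add hsq)
  have h1 : g' p + γ⁻¹ • (p - x) = 0 := by
    refine ext_inner_right ℝ fun v => ?_
    have h2 := DFunLike.congr_fun h0 v
    simp only [add_apply, smul_apply,
      InnerProductSpace.toDual_apply_apply, innerSL_apply_apply, smul_eq_mul, nsmul_eq_mul,
      zero_apply] at h2
    rw [inner_add_left, real_inner_smul_left, inner_zero_left, ← h2]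
    push_cast
    field_simp
  rw [eq_neg_of_add_eq_zero_left h1, smul_neg, smul_inv_smul₀ hγ.ne', neg_sub]

lemma moreau_gap_le_inner {g : E → ℝ} {g' : E → E} (hc : ConvexOn ℝ Set.univ g)
    (hg : ∀ x, HasGradientAt g (g' x) x) {γ : ℝ} (hγ : 0 < γ) {x p : E}
    (hp : x - p = γ • g' p) (z : E) :
    g p + ‖p - x‖ ^ 2 / (2 * γ) - g z ≤ ⟪g' p, x - z⟫ := by
  have h := hc.add_inner_gradient_le hg p z
  have hx : x - z = γ • g' p - (z - p) := by rw [← hp]; abel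
  rw [norm_sub_rev, hp, norm_smul, Real.norm_of_nonneg hγ.le, hx, inner_sub_right,
    real_inner_smul_right, real_inner_self_eq_norm_sq]
  have : (γ * ‖g' p‖) ^ 2 / (2 * γ) = γ * ‖g' p‖ ^ 2 / 2 := by field_simp
  nlinarith [mul_nonneg hγ.le (sq_nonneg ‖g' p‖)]

lemma gap_le_mul_moreau_gap {g : E → ℝ} {g' : E → E} (hg : ∀ x, HasGradientAt g (g' x) x)
    {L : ℝ} (hLpos : 0 < L) (hL : ∀ x y, ‖g' x - g' y‖ ≤ L * ‖x - y‖)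
    {γ : ℝ} (hγ : 0 < γ) {x p z : E} (hp : x - p = γ • g' p) (hz : ∀ y, g z ≤ g y) :
    g x - g z ≤ (1 + γ * L) * (g p + ‖p - x‖ ^ 2 / (2 * γ) - g z) := by
  have h1 := le_quadratic_of_lipschitz_gradient hg hL p (x - p)
  have h2 := (hz _).trans (le_quadratic_of_lipschitz_gradient hg hL p (-(L⁻¹ • g' p)))
  rw [add_sub_cancel, hp, real_inner_smul_right, real_inner_self_eq_norm_sq, norm_smul,
    Real.norm_of_nonneg hγ.le] at h1
  rw [norm_neg, inner_neg_right, real_inner_smul_right, real_inner_self_eq_norm_sq, norm_smul,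
    Real.norm_of_nonneg (inv_pos.2 hLpos).le] at h2
  rw [norm_sub_rev, hp, norm_smul, Real.norm_of_nonneg hγ.le]
  have e1 : (γ * ‖g' p‖) ^ 2 / (2 * γ) = γ * ‖g' p‖ ^ 2 / 2 := by field_simp
  have e2 : L * (-(L⁻¹ * ‖g' p‖ ^ 2) + L / 2 * (L⁻¹ * ‖g' p‖) ^ 2) = -(‖g' p‖ ^ 2 / 2) := by
    field_simp
    ring
  have h3 : ‖g' p‖ ^ 2 / 2 ≤ L * (g p - g z) := by nlinarith [mul_le_mul_of_nonneg_left h2 hLpos.le]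
  rw [e1]
  nlinarith [mul_le_mul_of_nonneg_left h3 hγ.le]

/-- One step of gradient descent with step size `1 / (4 L)` and a gradient error `b`, on an
`L`-smooth function with gap controlled by the gradient and with quadratic growth around `z`. -/
lemma inexact_gradient_step {F : E → ℝ} {F' : E → E} {L m : ℝ} (hL : 0 < L)
    (hF : ∀ x, HasGradientAt F (F' x) x) (hLip : ∀ x y, ‖F' x - F' y‖ ≤ L * ‖x - y‖)
    {z : E} (hz : ∀ x, F z ≤ F x)
    (hgap : ∀ x, F x - F z ≤ ⟪F' x, x - z⟫) (hm : 0 < m)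
    (hgrow : ∀ x, m / 2 * ‖x - z‖ ^ 2 ≤ F x - F z) (x b : E) :
    F (x + (1 / (4 * L)) • (b - F' x)) - F z
      ≤ (1 - m / (16 * L)) * (F x - F z) + ‖b‖ ^ 2 / (8 * L) := by
  have hdesc := le_quadratic_of_lipschitz_gradient hF hLip x ((1 / (4 * L)) • (b - F' x))
  have hD := sub_nonneg.2 (hz x)
  set D := F x - F z
  have hPL : m / 2 * D ≤ ‖F' x‖ ^ 2 := by
    have h1 := (hgap x).trans (real_inner_le_norm _ _)
    have h2 := pow_le_pow_left₀ hD h1 2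
    have h3 := mul_le_mul_of_nonneg_left (hgrow x) (sq_nonneg ‖F' x‖)
    rcases hD.eq_or_lt with h0 | h0
    · rw [← h0]; nlinarith [sq_nonneg ‖F' x‖]
    · refine le_of_mul_le_mul_right ?_ h0
      nlinarith
  rw [real_inner_smul_right, inner_sub_right, real_inner_self_eq_norm_sq, norm_smul, mul_pow,
    norm_sub_sq_real, Real.norm_of_nonneg (by positivity)] at hdesc
  have hyoung : 2 * ⟪F' x, b⟫ ≤ ‖F' x‖ ^ 2 + ‖b‖ ^ 2 := by
    nlinarith [norm_sub_sq_real (F' x) b, sq_nonneg ‖F' x - b‖]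
  rw [real_inner_comm (F' x) b] at hdesc
  have e1 : 1 / (4 * L) * (⟪F' x, b⟫ - ‖F' x‖ ^ 2)
      + L / 2 * ((1 / (4 * L)) ^ 2 * (‖b‖ ^ 2 - 2 * ⟪F' x, b⟫ + ‖F' x‖ ^ 2))
      = (1 / (8 * L)) * (3 / 2 * ⟪F' x, b⟫ - 7 / 4 * ‖F' x‖ ^ 2 + ‖b‖ ^ 2 / 4) := by
    field_simp
    ring
  have e2 : (1 - m / (16 * L)) * D + ‖b‖ ^ 2 / (8 * L)
      = D + (1 / (8 * L)) * (‖b‖ ^ 2 - m / 2 * D) := by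
    field_simp
    ring
  have h4 : (1 / (8 * L)) * (3 / 2 * ⟪F' x, b⟫ - 7 / 4 * ‖F' x‖ ^ 2 + ‖b‖ ^ 2 / 4)
      ≤ (1 / (8 * L)) * (‖b‖ ^ 2 - m / 2 * D) :=
    mul_le_mul_of_nonneg_left (by linarith) (by positivity)
  rw [e2]
  linarith

lemma inexact_gradient_descent {F : E → ℝ} {F' : E → E} {L m : ℝ} (hL : 0 < L)
    (hF : ∀ x, HasGradientAt F (F' x) x) (hLip : ∀ x y, ‖F' x - F' y‖ ≤ L * ‖x - y‖)
    {z : E} (hz : ∀ x, F z ≤ F x) (hz' : F' z = 0)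
    (hgap : ∀ x, F x - F z ≤ ⟪F' x, x - z⟫) (hm : 0 < m)
    (hgrow : ∀ x, m / 2 * ‖x - z‖ ^ 2 ≤ F x - F z) {x b : ℕ → E} {δ : ℝ}
    (hx : ∀ k, x (k + 1) = x k + (1 / (4 * L)) • (b k - F' (x k)))
    (hb : ∀ k, ‖b k‖ ^ 2 ≤ δ) (K : ℕ) :
    ‖x K - z‖ ^ 2 ≤ (1 - m / (32 * L)) ^ K * (L / m) * ‖x 0 - z‖ ^ 2 + 12 * δ / m ^ 2 := by
  have hδ : 0 ≤ δ := (sq_nonneg _).trans (hb 0)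
  rcases subsingleton_or_nontrivial E with hE | hE
  · rw [Subsingleton.elim (x K) z, Subsingleton.elim (x 0) z]
    have : 0 ≤ 12 * δ / m ^ 2 := by positivity
    simpa
  have hupper (y : E) : F y - F z ≤ L / 2 * ‖y - z‖ ^ 2 := by
    have h := le_quadratic_of_lipschitz_gradient hF hLip z (y - z)
    rw [add_sub_cancel, hz', inner_zero_left] at h
    linarith
  have hmL : m ≤ L := by
    obtain ⟨y, hy⟩ := exists_ne z
    have h := (hgrow y).trans (hupper y)
    have := le_of_mul_le_mul_right h (by have := norm_pos_iff.2 (sub_ne_zero.2 hy); positivity)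
    linarith
  have hρ : 0 ≤ 1 - m / (32 * L) := by
    rw [sub_nonneg, div_le_one (by positivity)]; linarith
  have hrate : ∀ k, F (x k) - F z ≤ (1 - m / (32 * L)) ^ k * (F (x 0) - F z) + 4 * δ / m := by
    intro k
    induction k with
    | zero => simp; positivity
    | succ k ih =>
      have h := inexact_gradient_step hL hF hLip hz hgap hm hgrow (x k) (b k)
      rw [← hx] at h
      have hD := sub_nonneg.2 (hz (x k))
      have h1 : ‖b k‖ ^ 2 / (8 * L) ≤ δ / (8 * L) := by gcongr; exact hb k
      have h2 : (1 - m / (16 * L)) * (F (x k) - F z) ≤ (1 - m / (32 * L)) * (F (x k) - F z) := by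
        gcongr
        linarith
      have h3 := mul_le_mul_of_nonneg_left ih hρ
      have e : (1 - m / (32 * L)) * (4 * δ / m) + δ / (8 * L) = 4 * δ / m := by
        field_simp
        ring
      rw [pow_succ]
      nlinarith
  have h1 := (hgrow (x K)).trans (hrate K)
  have h2 := mul_le_mul_of_nonneg_left (hupper (x 0)) (pow_nonneg hρ K)
  have h3 : m / 2 * ‖x K - z‖ ^ 2 ≤ m / 2 *
      ((1 - m / (32 * L)) ^ K * (L / m) * ‖x 0 - z‖ ^ 2 + 8 * δ / m ^ 2) := by
    refine (h1.trans (add_le_add_left h2 _)).trans_eq ?_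
    field_simp
    ring
  refine (le_of_mul_le_mul_left h3 (by positivity)).trans ?_
  gcongr
  norm_num

end SmoothConvex


theorem fedexprox_abs_Delta
    {d n : ℕ} (hn : 1 ≤ n)
    (f : Fin n → EuclideanSpace ℝ (Fin d) → ℝ)
    (f' : Fin n → EuclideanSpace ℝ (Fin d) → EuclideanSpace ℝ (Fin d))
    (L : Fin n → ℝ) (hLpos : ∀ i, 0 < L i)
    (hdiff : ∀ i x, HasGradientAt (f i) (f' i x) x)
    (hconv : ∀ i, ConvexOn ℝ Set.univ (f i))
    (hsmooth : ∀ i x y, ‖f' i x - f' i y‖ ≤ L i * ‖x - y‖)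
    (Lmax : ℝ) (hLmax : IsGreatest (Set.range L) Lmax)
    (xstar : EuclideanSpace ℝ (Fin d)) (hinterp : ∀ i, f' i xstar = 0)
    (μ : ℝ) (hμ : 0 < μ)
    (hsc : StrongConvexOn Set.univ μ (fun x => (1 / (n : ℝ)) * ∑ i, f i x))
    (γ : ℝ) (hγ : 0 < γ)
    (prox : Fin n → EuclideanSpace ℝ (Fin d) → EuclideanSpace ℝ (Fin d))
    (hprox : ∀ i x, IsMinOn (fun z => f i z + ‖z - x‖ ^ 2 / (2 * γ)) Set.univ (prox i x))
    (hproxu : ∀ i x q, IsMinOn (fun z => f i z + ‖z - x‖ ^ 2 / (2 * γ)) Set.univ q → q = prox i x)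
    (M : EuclideanSpace ℝ (Fin d) → ℝ)
    (hM : ∀ x, M x = (1 / (n : ℝ)) * ∑ i, (f i (prox i x) + ‖prox i x - x‖ ^ 2 / (2 * γ)))
    (M' : EuclideanSpace ℝ (Fin d) → EuclideanSpace ℝ (Fin d))
    (hM' : ∀ x, M' x = (1 / ((n : ℝ) * γ)) • ∑ i, (x - prox i x))
    (hMdiff : ∀ x, HasGradientAt M (M' x) x)
    (Minf : ℝ) (hMinf : Minf = M xstar) (hMinfLB : ∀ x, Minf ≤ M x)
    (Lγ : ℝ) (hLγ : 0 < Lγ)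
    (hMLip : ∀ x y, ‖M' x - M' y‖ ≤ Lγ * ‖x - y‖)
    (α : ℝ)
    (xseq : ℕ → EuclideanSpace ℝ (Fin d))
    (xtil : Fin n → ℕ → EuclideanSpace ℝ (Fin d))
    (hrec : ∀ k : ℕ, xseq (k + 1) = xseq k + α • ((1 / (n : ℝ)) • (∑ i, xtil i k) - xseq k))
    (ε₁ : ℝ) (hε₁ : 0 ≤ ε₁)
    (happrox : ∀ (i : Fin n) (k : ℕ), ‖xtil i k - prox i (xseq k)‖ ^ 2 ≤ ε₁)
    (hα : α = 1 / (4 * γ * Lγ))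
    : ∀ K : ℕ,
      ‖xseq K - xstar‖ ^ 2 ≤
        (1 - μ / (32 * Lγ * (1 + γ * Lmax))) ^ K * (Lγ * (1 + γ * Lmax) / μ) * ‖xseq 0 - xstar‖ ^ 2
          + 12 * ε₁ * ((1 / γ + Lmax) / μ) ^ 2 := by
  have hn0 : (0 : ℝ) < n := by exact_mod_cast hn
  obtain ⟨i₀, hi₀⟩ := hLmax.1
  have hLmax_pos : 0 < Lmax := hi₀ ▸ hLpos i₀
  have hsmooth' (i) (x y) : ‖f' i x - f' i y‖ ≤ Lmax * ‖x - y‖ :=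
    (hsmooth i x y).trans
      (mul_le_mul_of_nonneg_right (hLmax.2 (Set.mem_range_self i)) (norm_nonneg _))
  have hmin (i) (y) : f i xstar ≤ f i y := by
    simpa [hinterp] using (hconv i).add_inner_gradient_le (hdiff i) xstar y
  have hstat (i) (x) : x - prox i x = γ • f' i (prox i x) :=
    sub_prox_eq_smul_gradient (hdiff i) hγ (hprox i x)
  have hprox_star (i) : prox i xstar = xstar := by
    refine (hproxu i xstar xstar fun y _ => ?_).symm
    have := hmin i y
    have : 0 ≤ ‖y - xstar‖ ^ 2 / (2 * γ) := by positivity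
    simp only [Set.mem_ofPred_eq, sub_self, norm_zero]
    norm_num
    linarith
  have hMstar : M xstar = (1 / (n : ℝ)) * ∑ i, f i xstar := by simp [hM, hprox_star]
  have hM'star : M' xstar = 0 := by simp [hM', hprox_star]
  have hM'_eq (x) : M' x = (1 / (n : ℝ)) • ∑ i, f' i (prox i x) := by
    rw [hM', Finset.sum_congr rfl fun i _ => hstat i x, ← Finset.smul_sum, smul_smul]
    congr 1
    field_simp
  have hgap (x) : M x - M xstar ≤ ⟪M' x, x - xstar⟫ := by
    rw [hM, hMstar, hM'_eq, real_inner_smul_left, sum_inner, ← mul_sub, ← Finset.sum_sub_distrib]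
    gcongr with i
    exact moreau_gap_le_inner (hconv i) (hdiff i) hγ (hstat i x) xstar
  have hc : 0 < 1 + γ * Lmax := by positivity
  have hgrow (x) : μ / (1 + γ * Lmax) / 2 * ‖x - xstar‖ ^ 2 ≤ M x - M xstar := by
    have h1 := hsc.quadratic_growth_s3 (z := xstar) (fun y => by gcongr with i; exact hmin i y) x
    have h2 : (1 / (n : ℝ)) * ∑ i, f i x - (1 / (n : ℝ)) * ∑ i, f i xstar
        ≤ (1 + γ * Lmax) * (M x - M xstar) := by
      rw [hM, hMstar, ← mul_sub, ← mul_sub, ← Finset.sum_sub_distrib, ← Finset.sum_sub_distrib,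
        mul_left_comm, Finset.mul_sum (a := 1 + γ * Lmax)]
      gcongr with i
      exact gap_le_mul_moreau_gap (hdiff i) hLmax_pos (hsmooth' i) hγ (hstat i x) (hmin i)
    rw [div_div, div_mul_eq_mul_div, div_le_iff₀ (by positivity)]
    linarith
  intro K
  have hmain := inexact_gradient_descent hLγ hMdiff hMLip (fun x => hMinf ▸ hMinfLB x) hM'star
    hgap (div_pos hμ hc) hgrow (x := xseq)
    (b := fun k => γ⁻¹ • ((1 / (n : ℝ)) • ∑ i, (xtil i k - prox i (xseq k))))
    (δ := ε₁ / γ ^ 2) ?_ ?_ K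
  · have e1 : μ / (1 + γ * Lmax) / (32 * Lγ) = μ / (32 * Lγ * (1 + γ * Lmax)) := by field_simp
    have e2 : Lγ / (μ / (1 + γ * Lmax)) = Lγ * (1 + γ * Lmax) / μ := by field_simp
    have e3 : 12 * (ε₁ / γ ^ 2) / (μ / (1 + γ * Lmax)) ^ 2
        = 12 * ε₁ * ((1 / γ + Lmax) / μ) ^ 2 := by field_simp
    rwa [e1, e2, e3] at hmain
  · intro k
    have e : (1 / (n : ℝ)) • ∑ i, xtil i k - xseq k
        = γ • (γ⁻¹ • ((1 / (n : ℝ)) • ∑ i, (xtil i k - prox i (xseq k))) - M' (xseq k)) := by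
      rw [smul_sub, smul_inv_smul₀ hγ.ne', hM', smul_smul,
        show γ * (1 / ((n : ℝ) * γ)) = 1 / n by field_simp, ← smul_sub, ← Finset.sum_sub_distrib]
      have : ∀ i, xtil i k - prox i (xseq k) - (xseq k - prox i (xseq k)) = xtil i k - xseq k :=
        fun i => by abel
      simp only [this, Finset.sum_sub_distrib, Finset.sum_const, Finset.card_univ, Fintype.card_fin,
        smul_sub]
      rw [← Nat.cast_smul_eq_nsmul ℝ, smul_smul, one_div_mul_cancel hn0.ne', one_smul]
    rw [hrec, e, smul_smul, hα]
    congr 2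
    field_simp
  · intro k
    have hnorm : ‖(1 / (n : ℝ)) • ∑ i, (xtil i k - prox i (xseq k))‖ ≤ √ε₁ := by
      rw [norm_smul, Real.norm_of_nonneg (by positivity)]
      calc _ ≤ (1 / (n : ℝ)) * ∑ _i : Fin n, √ε₁ := by
            gcongr
            exact norm_sum_le_of_le _ fun i _ => Real.le_sqrt_of_sq_le (happrox i k)
        _ = √ε₁ := by simp; field_simp
    rw [norm_smul, Real.norm_of_nonneg (by positivity), mul_pow, inv_pow, inv_mul_eq_div]
    gcongr
    exact (pow_le_pow_left₀ (norm_nonneg _) hnorm 2).trans_eq (Real.sq_sqrt hε₁)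
end

section
/- Let f : ℝ^d → ℝ be differentiable, convex and L-smooth (∇f is L-Lipschitz, L > 0), fix γ > 0 and x ∈ ℝ^d, and let p = prox_{γf}(x) be the unique minimizer of A(z) = f(z) + ‖z − x‖²/(2γ). Let (z_t) be Nesterov's accelerated gradient iterates on A started from z₀ = z_{−1} = x: y_{t+1} = z_t + β(z_t − z_{t−1}) and z_{t+1} = y_{t+1} − η∇A(y_{t+1}), with step size η = γ/(1 + γL) and momentum β = (√(1 + γL) − 1)/(√(1 + γL) + 1). Then for every t ≥ 0, ‖z_t − p‖² ≤ 2(1 + γL) · (1 − 1/√(1 + γL))^t · ‖x − p‖²; in particular, for every ε₁ > 0 and every natural number t with t ≥ √(1 + γL) · log(2(1 + γL)‖x − p‖²/ε₁), one has ‖z_t − p‖² ≤ ε₁. -/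
section AcceleratedGradient

variable {E : Type*} [NormedAddCommGroup E] [InnerProductSpace ℝ E]

/-- One step of accelerated gradient descent contracts the Lyapunov function
`A z - A p + μ / 2 * ‖v - p‖ ^ 2` by the factor `1 - q`. -/
theorem lyapunov_accelerated_step (A : E → ℝ) {μ q : ℝ} (hμ : 0 < μ) (hq0 : 0 ≤ q) (hq1 : q ≤ 1)
    {y g z v p z' v' : E}
    (hlower : ∀ w, A y + inner ℝ g (w - y) + μ / 2 * ‖w - y‖ ^ 2 ≤ A w)
    (hdescent : A z' ≤ A y - q ^ 2 / (2 * μ) * ‖g‖ ^ 2)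
    (hz : z = y + q • (y - v))
    (hv' : v' = (1 - q) • v + q • y - (q / μ) • g) :
    A z' - A p + μ / 2 * ‖v' - p‖ ^ 2 ≤ (1 - q) * (A z - A p + μ / 2 * ‖v - p‖ ^ 2) := by
  have h1 := hlower z
  have h2 := hlower p
  have e1 : z - y = q • ((y - p) - (v - p)) := by rw [hz]; module
  have e2 : p - y = -(y - p) := by abel
  have e3 : v' - p = ((1 - q) • (v - p) + q • (y - p)) - (q / μ) • g := by rw [hv']; module
  rw [e1] at h1
  rw [e2, norm_neg, inner_neg_right] at h2
  rw [e3]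
  generalize v - p = a at *
  generalize y - p = b at *
  have h1' : A y + q * (inner ℝ g b - inner ℝ g a) ≤ A z := by
    rw [inner_smul_right, inner_sub_right] at h1
    nlinarith [mul_nonneg hμ.le (sq_nonneg ‖q • (b - a)‖)]
  have n1 : ‖((1 - q) • a + q • b) - (q / μ) • g‖ ^ 2
      = (1 - q) * ‖a‖ ^ 2 + q * ‖b‖ ^ 2 - q * (1 - q) * ‖b - a‖ ^ 2
        - 2 * (q / μ) * ((1 - q) * inner ℝ g a + q * inner ℝ g b) + (q / μ) ^ 2 * ‖g‖ ^ 2 := by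
    simp only [← real_inner_self_eq_norm_sq, inner_sub_left, inner_sub_right, inner_add_left,
      inner_add_right, inner_smul_left, inner_smul_right, real_inner_comm g, real_inner_comm b a,
      RCLike.conj_to_real]
    ring
  rw [n1]
  have n2 : μ / 2 * ((1 - q) * ‖a‖ ^ 2 + q * ‖b‖ ^ 2 - q * (1 - q) * ‖b - a‖ ^ 2
        - 2 * (q / μ) * ((1 - q) * inner ℝ g a + q * inner ℝ g b) + (q / μ) ^ 2 * ‖g‖ ^ 2)
      = μ / 2 * ((1 - q) * ‖a‖ ^ 2 + q * ‖b‖ ^ 2) - μ / 2 * (q * (1 - q) * ‖b - a‖ ^ 2)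
        - q * ((1 - q) * inner ℝ g a + q * inner ℝ g b) + q ^ 2 / (2 * μ) * ‖g‖ ^ 2 := by
    field_simp
  rw [n2]
  have h3 : 0 ≤ μ / 2 * (q * (1 - q) * ‖b - a‖ ^ 2) := by
    have := sub_nonneg.2 hq1
    positivity
  have h4 := mul_le_mul_of_nonneg_left h1' (sub_nonneg.2 hq1)
  have h5 := mul_le_mul_of_nonneg_left h2 hq0
  linarith

/-- A gradient step of length `1 / Λ` on a function with a `Λ`-quadratic upper model. -/
theorem gradient_step_descent {A : E → ℝ} {Λ : ℝ} (hΛ : Λ ≠ 0) {y g : E}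
    (hupper : ∀ w, A w ≤ A y + inner ℝ g (w - y) + Λ / 2 * ‖w - y‖ ^ 2) :
    A (y - (1 / Λ) • g) ≤ A y - 1 / (2 * Λ) * ‖g‖ ^ 2 := by
  have h := hupper (y - (1 / Λ) • g)
  have e : y - (1 / Λ) • g - y = -((1 / Λ) • g) := by abel
  rw [e, inner_neg_right, inner_smul_right, real_inner_self_eq_norm_sq, norm_neg, norm_smul,
    mul_pow, Real.norm_eq_abs, sq_abs] at h
  refine h.trans (le_of_eq ?_)
  field_simp
  ring

variable [CompleteSpace E]

theorem HasGradientAt.hasDerivAt_comp_add_smul {f : E → ℝ} {f' : E → E}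
    (hf : ∀ x, HasGradientAt f (f' x) x) (x u : E) (t : ℝ) :
    HasDerivAt (fun s : ℝ => f (x + s • u)) (inner ℝ (f' (x + t • u)) u) t := by
  have h1 : HasDerivAt (fun s : ℝ => x + s • u) u t := by
    simpa using ((hasDerivAt_id t).smul_const u).const_add x
  simpa [Function.comp_def] using (hf (x + t • u)).hasFDerivAt.comp_hasDerivAt t h1

/-- The first-order characterization of convexity. -/
theorem ConvexOn.add_inner_gradient_le_s10 {f : E → ℝ} {f' : E → E}
    (hconv : ConvexOn ℝ Set.univ f) (hf : ∀ x, HasGradientAt f (f' x) x) (x w : E) :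
    f x + inner ℝ (f' x) (w - x) ≤ f w := by
  have hc : ConvexOn ℝ Set.univ (fun s : ℝ => f (x + s • (w - x))) := by
    have := hconv.comp_affineMap (AffineMap.lineMap x w : ℝ →ᵃ[ℝ] E)
    simpa [Function.comp_def, AffineMap.lineMap_apply, add_comm] using this
  have := hc.le_slope_of_hasDerivAt (Set.mem_univ 0) (Set.mem_univ 1) one_pos
    (HasGradientAt.hasDerivAt_comp_add_smul hf x (w - x) 0)
  simp [slope] at this
  linarith

/-- The descent lemma for functions with Lipschitz gradient. -/
theorem le_add_inner_gradient_of_lipschitz {f : E → ℝ} {f' : E → E} {L : ℝ}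
    (hf : ∀ x, HasGradientAt f (f' x) x) (hL : ∀ u v, ‖f' u - f' v‖ ≤ L * ‖u - v‖) (x w : E) :
    f w ≤ f x + inner ℝ (f' x) (w - x) + L / 2 * ‖w - x‖ ^ 2 := by
  set u := w - x with hu
  have hd : ∀ t : ℝ, HasDerivAt
      (fun s : ℝ => f (x + s • u) - s * inner ℝ (f' x) u - L / 2 * ‖u‖ ^ 2 * s ^ 2)
      (inner ℝ (f' (x + t • u)) u - inner ℝ (f' x) u - L * ‖u‖ ^ 2 * t) t := fun t => by
    have h := ((HasGradientAt.hasDerivAt_comp_add_smul hf x u t).sub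
      ((hasDerivAt_id t).mul_const (inner ℝ (f' x) u))).sub
      ((hasDerivAt_pow 2 t).const_mul (L / 2 * ‖u‖ ^ 2))
    exact h.congr_deriv (by norm_num; ring)
  have hanti : AntitoneOn
      (fun s : ℝ => f (x + s • u) - s * inner ℝ (f' x) u - L / 2 * ‖u‖ ^ 2 * s ^ 2)
      (Set.Icc 0 1) := by
    refine antitoneOn_of_deriv_nonpos (convex_Icc 0 1)
      (fun t _ => (hd t).continuousAt.continuousWithinAt)
      (fun t _ => (hd t).differentiableAt.differentiableWithinAt) fun t ht => ?_
    rw [interior_Icc] at ht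
    rw [(hd t).deriv, ← inner_sub_left]
    have h1 := real_inner_le_norm (f' (x + t • u) - f' x) u
    have h2 := hL (x + t • u) x
    rw [add_sub_cancel_left, norm_smul, Real.norm_of_nonneg ht.1.le] at h2
    have h3 := mul_le_mul_of_nonneg_right h2 (norm_nonneg u)
    nlinarith
  have := hanti (Set.left_mem_Icc.2 zero_le_one) (Set.right_mem_Icc.2 zero_le_one) zero_le_one
  simp [hu] at this
  linarith

/-- A proximal objective `f + ‖· - x‖ ^ 2 / (2 * γ)` is `1 / γ`-strongly convex. -/
theorem proximal_lower_bound {f : E → ℝ} {f' : E → E}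
    (hconv : ConvexOn ℝ Set.univ f) (hf : ∀ x, HasGradientAt f (f' x) x) (γ : ℝ) (x y w : E) :
    f y + ‖y - x‖ ^ 2 / (2 * γ) + inner ℝ (f' y + (1 / γ) • (y - x)) (w - y)
      + 1 / γ / 2 * ‖w - y‖ ^ 2 ≤ f w + ‖w - x‖ ^ 2 / (2 * γ) := by
  have h := hconv.add_inner_gradient_le_s10 hf y w
  have e : ‖w - x‖ ^ 2 = ‖y - x‖ ^ 2 + 2 * inner ℝ (y - x) (w - y) + ‖w - y‖ ^ 2 := by
    rw [← norm_add_sq_real]; congr 2; abel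
  rw [e, inner_add_left, inner_smul_left, RCLike.conj_to_real]
  refine le_trans (le_of_eq ?_) (add_le_add_left h _)
  ring

/-- A proximal objective `f + ‖· - x‖ ^ 2 / (2 * γ)` is `(L + 1 / γ)`-smooth. -/
theorem proximal_upper_bound {f : E → ℝ} {f' : E → E} {L : ℝ}
    (hf : ∀ x, HasGradientAt f (f' x) x) (hL : ∀ u v, ‖f' u - f' v‖ ≤ L * ‖u - v‖)
    (γ : ℝ) (x y w : E) :
    f w + ‖w - x‖ ^ 2 / (2 * γ) ≤
      f y + ‖y - x‖ ^ 2 / (2 * γ) + inner ℝ (f' y + (1 / γ) • (y - x)) (w - y)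
        + (L + 1 / γ) / 2 * ‖w - y‖ ^ 2 := by
  have h := le_add_inner_gradient_of_lipschitz hf hL y w
  have e : ‖w - x‖ ^ 2 = ‖y - x‖ ^ 2 + 2 * inner ℝ (y - x) (w - y) + ‖w - y‖ ^ 2 := by
    rw [← norm_add_sq_real]; congr 2; abel
  rw [e, inner_add_left, inner_smul_left, RCLike.conj_to_real]
  refine le_trans (add_le_add_left h _) (le_of_eq ?_)
  ring

end AcceleratedGradient

theorem Real.mul_one_sub_pow_le_of_log_le {C ε q : ℝ} (hC : 0 ≤ C) (hε : 0 < ε) (hq : q ≤ 1)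
    {t : ℕ} (ht : Real.log (C / ε) ≤ q * t) : C * (1 - q) ^ t ≤ ε := by
  rcases hC.eq_or_lt with rfl | hC
  · simpa using hε.le
  have h1 : (1 - q) ^ t ≤ Real.exp (-(q * t)) := by
    have := pow_le_pow_left₀ (sub_nonneg.2 hq) (Real.one_sub_le_exp_neg q) t
    rwa [← Real.exp_nat_mul, mul_neg, mul_comm (t : ℝ)] at this
  have h2 : C / ε ≤ Real.exp (q * t) := (Real.log_le_iff_le_exp (by positivity)).1 ht
  rw [Real.exp_neg] at h1
  calc C * (1 - q) ^ t ≤ C * (Real.exp (q * t))⁻¹ := by gcongr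
    _ ≤ ε := by
      rw [div_le_iff₀ hε] at h2
      rw [mul_inv_le_iff₀ (Real.exp_pos _)]
      linarith


theorem local_agd_abs
    {d : ℕ}
    (f : EuclideanSpace ℝ (Fin d) → ℝ)
    (f' : EuclideanSpace ℝ (Fin d) → EuclideanSpace ℝ (Fin d))
    (L : ℝ) (hL : 0 < L)
    (hdiff : ∀ x, HasGradientAt f (f' x) x)
    (hconv : ConvexOn ℝ Set.univ f)
    (hsmooth : ∀ u v, ‖f' u - f' v‖ ≤ L * ‖u - v‖)
    (γ : ℝ) (hγ : 0 < γ)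
    (x p : EuclideanSpace ℝ (Fin d))
    (hp : IsMinOn (fun z => f z + ‖z - x‖ ^ 2 / (2 * γ)) Set.univ p)
    (hpu : ∀ q, IsMinOn (fun z => f z + ‖z - x‖ ^ 2 / (2 * γ)) Set.univ q → q = p)
    (A' : EuclideanSpace ℝ (Fin d) → EuclideanSpace ℝ (Fin d))
    (hA' : ∀ z, A' z = f' z + (1 / γ) • (z - x))
    (η β : ℝ)
    (hη : η = γ / (1 + γ * L))
    (hβ : β = (Real.sqrt (1 + γ * L) - 1) / (Real.sqrt (1 + γ * L) + 1))
    (z y : ℕ → EuclideanSpace ℝ (Fin d))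
    (hz0 : z 0 = x)
    (hy : ∀ t : ℕ, y (t + 1) = z t + β • (z t - (if t = 0 then x else z (t - 1))))
    (hzrec : ∀ t : ℕ, z (t + 1) = y (t + 1) - η • A' (y (t + 1)))
    : (∀ t : ℕ, ‖z t - p‖ ^ 2 ≤ 2 * (1 + γ * L) * (1 - 1 / Real.sqrt (1 + γ * L)) ^ t * ‖x - p‖ ^ 2) ∧
      ∀ ε₁ : ℝ, 0 < ε₁ → ∀ t : ℕ,
        Real.sqrt (1 + γ * L) * Real.log (2 * (1 + γ * L) * ‖x - p‖ ^ 2 / ε₁) ≤ (t : ℝ) →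
          ‖z t - p‖ ^ 2 ≤ ε₁ := by
  set s := Real.sqrt (1 + γ * L) with hs
  have hγL : 0 < γ * L := mul_pos hγ hL
  have hs2 : 1 + γ * L = s ^ 2 := (Real.sq_sqrt (by linarith)).symm
  have hs1 : 1 ≤ s := Real.one_le_sqrt.2 (by linarith)
  have hs0 : 0 < s := by linarith
  have hq0 : 0 ≤ 1 / s := by positivity
  have hq1 : 1 / s ≤ 1 := (div_le_one hs0).2 hs1
  have hμ : 0 < 1 / γ := by positivity
  have hΛ : L + 1 / γ = s ^ 2 / γ := by rw [← hs2]; field_simp; ring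
  have hΛη : 1 / (s ^ 2 / γ) = η := by rw [hη, hs2, one_div_div]
  set A : EuclideanSpace ℝ (Fin d) → ℝ := fun z => f z + ‖z - x‖ ^ 2 / (2 * γ)
  have hlow : ∀ y w, A y + inner ℝ (A' y) (w - y) + 1 / γ / 2 * ‖w - y‖ ^ 2 ≤ A w := fun y w => by
    rw [hA']; exact proximal_lower_bound hconv hdiff γ x y w
  have hup : ∀ y w, A w ≤ A y + inner ℝ (A' y) (w - y) + s ^ 2 / γ / 2 * ‖w - y‖ ^ 2 :=
    fun y w => by
      rw [hA', ← hΛ]; exact proximal_upper_bound hdiff hsmooth γ x y w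
  have hdesc : ∀ y, A (y - η • A' y) ≤ A y - 1 / (2 * (s ^ 2 / γ)) * ‖A' y‖ ^ 2 := fun y => by
    rw [← hΛη]; exact gradient_step_descent (by positivity) (hup y)
  have hAp : A' p = 0 := by
    have h1 := hdesc p
    have h2 : A p ≤ A (p - η • A' p) := hp (Set.mem_univ _)
    have h3 : 0 < 1 / (2 * (s ^ 2 / γ)) := by positivity
    have h4 : ‖A' p‖ ^ 2 ≤ 0 := by
      by_contra! h
      have := mul_pos h3 h
      linarith
    simpa using h4
  set v : ℕ → EuclideanSpace ℝ (Fin d) :=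
    fun t => z t + (s - 1) • (z t - (if t = 0 then x else z (t - 1))) with hv
  have hstep : ∀ t, A (z (t + 1)) - A p + 1 / γ / 2 * ‖v (t + 1) - p‖ ^ 2
      ≤ (1 - 1 / s) * (A (z t) - A p + 1 / γ / 2 * ‖v t - p‖ ^ 2) := fun t => by
    refine lyapunov_accelerated_step A hμ hq0 hq1 (hlow (y (t + 1))) ?_ ?_ ?_
    · rw [hzrec]
      refine (hdesc _).trans (le_of_eq ?_)
      field_simp
    · simp only [hv, hy, hβ]
      match_scalars <;> field_simp <;> ring
    · simp only [hv, hzrec, Nat.add_sub_cancel, Nat.succ_ne_zero, if_false]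
      generalize A' (y (t + 1)) = g
      rw [hy, hη, hs2, hβ]
      match_scalars <;> field_simp <;> ring
  have hΦ : ∀ t, A (z t) - A p + 1 / γ / 2 * ‖v t - p‖ ^ 2
      ≤ (1 - 1 / s) ^ t * (A x - A p + 1 / γ / 2 * ‖x - p‖ ^ 2) := fun t => by
    induction t with
    | zero => simp [hv, hz0]
    | succ t ih =>
      refine (hstep t).trans ?_
      rw [pow_succ' _ t, mul_assoc]
      exact mul_le_mul_of_nonneg_left ih (sub_nonneg.2 hq1)
  have hbound : ∀ t, ‖z t - p‖ ^ 2 ≤ 2 * s ^ 2 * (1 - 1 / s) ^ t * ‖x - p‖ ^ 2 := fun t => by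
    have h1 := hlow p (z t)
    have h2 := hup p x
    rw [hAp, inner_zero_left] at h1 h2
    have hr : 0 ≤ (1 - 1 / s) ^ t := pow_nonneg (sub_nonneg.2 hq1) t
    have h3 : A x - A p + 1 / γ / 2 * ‖x - p‖ ^ 2 ≤ 1 / γ / 2 * (2 * s ^ 2 * ‖x - p‖ ^ 2) := by
      have : 1 / γ / 2 * ‖x - p‖ ^ 2 ≤ s ^ 2 / γ / 2 * ‖x - p‖ ^ 2 := by
        gcongr
        exact one_le_pow₀ hs1
      calc _ ≤ s ^ 2 / γ / 2 * ‖x - p‖ ^ 2 + s ^ 2 / γ / 2 * ‖x - p‖ ^ 2 := by linarith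
        _ = _ := by ring
    have h4 := (hΦ t).trans (mul_le_mul_of_nonneg_left h3 hr)
    have h5 : 0 ≤ 1 / γ / 2 * ‖v t - p‖ ^ 2 := by positivity
    have h6 : 1 / γ / 2 * ‖z t - p‖ ^ 2
        ≤ 1 / γ / 2 * (2 * s ^ 2 * (1 - 1 / s) ^ t * ‖x - p‖ ^ 2) := by
      linarith
    exact le_of_mul_le_mul_left h6 (by positivity)
  rw [hs2]
  refine ⟨hbound, fun ε₁ hε t ht => (hbound t).trans ?_⟩
  rw [mul_right_comm]
  refine Real.mul_one_sub_pow_le_of_log_le (by positivity) hε hq1 ?_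
  rwa [one_div, ← div_eq_inv_mul, le_div_iff₀' hs0]
end
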